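/- Let q be a prime power with gcd(d−1, q) = 1, let d ≥ 3 be an integer with e := gcd(d, q−1) ≥ 2, let γ ∈ Γ_e \ {1}, and let k ≥ 1. Then deg rad(G*_{k,γ}) ≥ (d−1)·d^{k−1}. -/

import Mathlib

open Polynomial in
/-- The iterates `F_0(X) = X`, `F_k(X) = F_{k-1}(X)^d + X`. -/
noncomputable def Fiter (F : Type*) [Field F] (d : ℕ) : ℕ → Polynomial F
  | 0 => Polynomial.X
  | (k + 1) => (Fiter F d k) ^ d + Polynomial.X

/-- The polynomials `G_{k,γ}(X) = γ·F_k(X) − X`. -/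
noncomputable def Gpoly (F : Type*) [Field F] (d : ℕ) (γ : F) (k : ℕ) : Polynomial F :=
  Polynomial.C γ * Fiter F d k - Polynomial.X

/-- `F_k = X · H` with `H(0) = 1`. -/
theorem Fiter_eq_X_mul (F : Type*) [Field F] {d : ℕ} (hd : 2 ≤ d) (k : ℕ) :
    ∃ H : Polynomial F, Fiter F d k = Polynomial.X * H ∧ H.coeff 0 = 1 := by
  induction k with
  | zero => exact ⟨1, by simp [Fiter]⟩
  | succ k ih =>
    obtain ⟨H, hH, -⟩ := ih
    obtain ⟨m, rfl⟩ := Nat.exists_eq_add_of_le hd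
    refine ⟨Polynomial.X ^ (m + 1) * H ^ (2 + m) + 1, ?_, ?_⟩
    · rw [Fiter, hH]
      ring
    · simp [Polynomial.mul_coeff_zero]

theorem natDegree_Fiter (F : Type*) [Field F] {d : ℕ} (hd : 2 ≤ d) (k : ℕ) :
    (Fiter F d k).natDegree = d ^ k := by
  induction k with
  | zero => simp [Fiter]
  | succ k ih =>
    have hdeg : (Fiter F d k ^ d).natDegree = d ^ (k + 1) := by
      rw [Polynomial.natDegree_pow, ih, pow_succ']
    rw [Fiter, Polynomial.natDegree_add_eq_left_of_natDegree_lt, hdeg]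
    rw [hdeg, Polynomial.natDegree_X]
    exact Nat.one_lt_pow k.succ_ne_zero hd

theorem cast_ne_zero_of_gcd_card_eq_one {F : Type*} [Field F] [Fintype F] {n : ℕ}
    (h : Nat.gcd n (Fintype.card F) = 1) : (n : F) ≠ 0 := by
  intro h0
  obtain ⟨a, b, hab⟩ := Nat.isCoprime_iff_coprime.mpr h
  have := congrArg (Int.cast : ℤ → F) hab
  simp [h0] at this

open UniqueFactorizationMonoid in
/-- Mason–Stothers bound for `A + c`, where `A` has nonzero derivative and `c` is a
nonzero constant. -/
theorem natDegree_add_one_le_add_natDegree_radical {F : Type*} [Field F] [DecidableEq F]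
    {A : Polynomial F} {c : F} (hc : c ≠ 0) (hA : Polynomial.derivative A ≠ 0) :
    A.natDegree + 1 ≤
      (radical A).natDegree + (radical (A + Polynomial.C c)).natDegree := by
  have hcu : IsUnit (Polynomial.C c) := Polynomial.isUnit_C.mpr hc.isUnit
  have hA0 : A ≠ 0 := fun h => hA (by simp [h])
  have hS0 : A + Polynomial.C c ≠ 0 := fun h => hA (by
    simpa using congrArg Polynomial.derivative h)
  rcases Polynomial.abc hA0 hcu.ne_zero (neg_ne_zero.mpr hS0)
    (isCoprime_one_left.of_isCoprime_of_dvd_left hcu.dvd).symm (by ring) with h | h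
  · refine h.1.trans ?_
    rw [mul_neg, UniqueFactorizationDomain.radical_neg, mul_assoc, mul_left_comm,
      radical_mul_of_isUnit_left hcu,
      ← Polynomial.natDegree_mul radical_ne_zero radical_ne_zero]
    exact Polynomial.natDegree_le_of_dvd radical_mul_dvd
      (mul_ne_zero radical_ne_zero radical_ne_zero)
  · exact absurd h.1 hA

open UniqueFactorizationMonoid in
theorem stmt17 (F : Type*) [Field F] [Fintype F] [DecidableEq F]
    (d : ℕ) (hd : 3 ≤ d)
    (hdq : Nat.gcd (d - 1) (Fintype.card F) = 1)
    (e : ℕ) (he : e = Nat.gcd d (Fintype.card F - 1)) (he2 : 2 ≤ e)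
    (γ : F) (hγ : γ ^ e = 1) (hγ1 : γ ≠ 1) (k : ℕ) (hk : 1 ≤ k) :
    (d - 1) * d ^ (k - 1) ≤ (radical (Gpoly F d γ k / Polynomial.X)).natDegree := by
  have hγ0 : γ ≠ 0 := by
    rintro rfl
    rw [zero_pow (by omega)] at hγ
    exact zero_ne_one hγ
  have hd1 := cast_ne_zero_of_gcd_card_eq_one hdq
  obtain ⟨k, rfl⟩ := Nat.exists_eq_add_of_le' hk
  obtain ⟨m, rfl⟩ := Nat.exists_eq_add_of_le' hd
  obtain ⟨H, hH, hH0⟩ := Fiter_eq_X_mul F (d := m + 3) (by omega) k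
  have hdeg := natDegree_Fiter F (d := m + 3) (by omega) k
  have hF0 : Fiter F (m + 3) k ≠ 0 := by
    intro h
    rw [h, Polynomial.natDegree_zero] at hdeg
    exact pow_ne_zero k (by omega) hdeg.symm
  set A : Polynomial F := Polynomial.C γ * (Polynomial.X ^ (m + 2) * H ^ (m + 3)) with hAdef
  have hXA : Polynomial.X * A = Polynomial.C γ * Fiter F (m + 3) k ^ (m + 3) := by
    rw [hAdef, hH]
    ring
  have hG : Gpoly F (m + 3) γ (k + 1) / Polynomial.X = A + Polynomial.C (γ - 1) := by
    have : Gpoly F (m + 3) γ (k + 1) = Polynomial.X * (A + Polynomial.C (γ - 1)) := by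
      rw [mul_add, hXA, Gpoly, Fiter, Polynomial.C_sub, Polynomial.C_1]
      ring
    rw [this, mul_div_cancel_left₀ _ Polynomial.X_ne_zero]
  have hA' : Polynomial.derivative A ≠ 0 := by
    intro h
    have hcoeff := congrArg (Polynomial.coeff · (m + 1)) h
    have hpow : (H ^ (m + 3)).coeff 0 = 1 := by
      rw [Polynomial.coeff_zero_eq_eval_zero] at hH0 ⊢
      simp [hH0]
    have hAc : A.coeff (m + 2) = γ := by
      have := Polynomial.coeff_X_pow_mul (H ^ (m + 3)) (m + 2) 0
      rw [zero_add] at this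
      rw [hAdef, Polynomial.coeff_C_mul, this, hpow, mul_one]
    simp only [Polynomial.coeff_derivative, Polynomial.coeff_zero] at hcoeff
    rw [hAc] at hcoeff
    refine hd1 ((mul_eq_zero.mp hcoeff).resolve_left hγ0 ▸ ?_)
    push_cast [show m + 3 - 1 = m + 1 + 1 by omega]
    rfl
  have hA0 : A ≠ 0 := fun h => hA' (by simp [h])
  have hAdeg : A.natDegree + 1 = (m + 3) * (m + 3) ^ k := by
    rw [← Polynomial.natDegree_X_mul hA0, hXA, Polynomial.natDegree_C_mul hγ0,
      Polynomial.natDegree_pow, hdeg]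
  have hrad : (radical A).natDegree ≤ (m + 3) ^ k := by
    rw [← hdeg]
    refine Polynomial.natDegree_le_of_dvd ?_ hF0
    have hdvd : A ∣ Polynomial.C γ * Fiter F (m + 3) k ^ (m + 3) := hXA ▸ dvd_mul_left _ _
    rw [(Polynomial.isUnit_C.mpr hγ0.isUnit).dvd_mul_left] at hdvd
    exact (radical_dvd_radical hdvd (pow_ne_zero _ hF0)).trans
      (radical_pow_dvd.trans radical_dvd_self)
  have hmain := natDegree_add_one_le_add_natDegree_radical (sub_ne_zero.mpr hγ1) hA'
  rw [hG, Nat.sub_mul, Nat.add_sub_cancel, one_mul]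
  omega
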